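/- Let W be a nonempty word over A^{±1} and suppose B_0, B_1, ..., B_ℓ is a sequence of pseudobracket systems for W (with respect to presentation (1.2)) in which B_0 is empty and each B_{i+1} is obtained from B_i by an elementary operation. Then for every i and every pseudobracket b ∈ B_i: if b has type PB1, then the subword W(b(1)..b(2)] is a product of b(6) conjugates of words in R_2^{±1} in F(A) (in particular W(b(1)..b(2)] = 1 in G_2); and if b has type PB2, then W(b(1)..b(2)]·a_{b(3)}^{-b(5)} is a product of b(6) conjugates of words in R_2^{±1} in F(A) (in particular W(b(1)..b(2)] = a_{b(3)}^{b(5)} in G_2). [group-theoretic content of Claims (C1)–(C2) in the proof of Lemma 4.7] -/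

import Mathlib

namespace Stmt10

/-- Words over the alphabet `A^{±1}` where `A = {a_1, ..., a_m}`. -/
abbrev Word (m : ℕ) := List (Fin m × Bool)

/-- The image of a word in the free group `F(A)`. -/
def evalW {m : ℕ} (w : Word m) : FreeGroup (Fin m) := FreeGroup.mk w

/-- The relator set `R_2 = {a_i^k : k ∈ E_i, k ≠ 0}` of presentation (1.2), as a set of
elements of the free group `F(A)`. -/
def Rel2 (m : ℕ) (E : Fin m → Set ℕ) : Set (FreeGroup (Fin m)) :=
  {g | ∃ (i : Fin m) (k : ℕ), k ∈ E i ∧ k ≠ 0 ∧ g = FreeGroup.of i ^ k}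

/-- `g` is a product of exactly `n` conjugates of elements of `R ∪ R⁻¹`. -/
def IsProdConj {G : Type*} [Group G] (R : Set G) (n : ℕ) (g : G) : Prop :=
  ∃ r s : Fin n → G,
    (∀ i, r i ∈ R ∨ (r i)⁻¹ ∈ R) ∧
    g = (List.ofFn fun i => s i * r i * (s i)⁻¹).prod

/-- A pseudobracket for presentation (1.2): the 6-tuple `(b(1), ..., b(6))`.  The third
component `c3 = j` encodes the generator index: `c3 = 0` for pseudobrackets of type PB1
and `c3 = j ∈ {1, ..., m}` (meaning the generator `a_j`) for type PB2. -/
structure PB where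
  c1 : ℕ
  c2 : ℕ
  c3 : ℕ
  c4 : ℕ
  c5 : ℤ
  c6 : ℕ
deriving DecidableEq

/-- The sign `ε = ±1` of a letter. -/
def sgn (ε : Bool) : ℤ := if ε then 1 else -1

/-- Type PB1: `b(3) = b(4) = b(5) = 0`. -/
def IsPB1 (b : PB) : Prop := b.c3 = 0 ∧ b.c4 = 0 ∧ b.c5 = 0

/-- Type PB2: `b(3) ∈ {1, ..., m}`, `b(4) ∈ E_{b(3)}`, `0 < b(4) ≤ |W|`,
`-b(4) < b(5) < b(4)`. -/
def IsPB2 (m : ℕ) (E : Fin m → Set ℕ) (W : Word m) (b : PB) : Prop :=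
  ∃ i : Fin m, b.c3 = (i : ℕ) + 1 ∧ b.c4 ∈ E i ∧ 0 < b.c4 ∧ b.c4 ≤ W.length ∧
    -(b.c4 : ℤ) < b.c5 ∧ b.c5 < (b.c4 : ℤ)

/-- A pseudobracket for the word `W`: `0 ≤ b(1) ≤ b(2) ≤ |W|`, `0 ≤ b(6) ≤ |W|`, and
`b` has type PB1 or PB2. -/
def ValidPB (m : ℕ) (E : Fin m → Set ℕ) (W : Word m) (b : PB) : Prop :=
  b.c1 ≤ b.c2 ∧ b.c2 ≤ W.length ∧ b.c6 ≤ W.length ∧ (IsPB1 b ∨ IsPB2 m E W b)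

/-- A pseudobracket system for `W`: a finite set of pseudobrackets such that for
distinct `b, c` either `b(2) ≤ c(1)` or `c(2) ≤ b(1)`. -/
def IsPBS (m : ℕ) (E : Fin m → Set ℕ) (W : Word m) (B : Finset PB) : Prop :=
  (∀ b ∈ B, ValidPB m E W b) ∧
    ∀ b ∈ B, ∀ c ∈ B, b ≠ c → b.c2 ≤ c.c1 ∨ c.c2 ≤ b.c1

/-- The elementary operations over pseudobracket systems for `W` with respect to
presentation (1.2): additions, extensions of types 1–3, turns and mergers; each
operation is required to produce again a pseudobracket system. -/
inductive Step (m : ℕ) (E : Fin m → Set ℕ) (W : Word m) :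
    Finset PB → Finset PB → Prop
  | add (B : Finset PB) (v : ℕ) (hv : v ≤ W.length)
      (hnot : (⟨v, v, 0, 0, 0, 0⟩ : PB) ∉ B)
      (hpbs : IsPBS m E W (insert (⟨v, v, 0, 0, 0, 0⟩ : PB) B)) :
      Step m E W B (insert (⟨v, v, 0, 0, 0, 0⟩ : PB) B)
  | ext1L (B : Finset PB) (b b' : PB) (hb : b ∈ B) (i : Fin m) (ε : Bool)
      (hg : b.c3 = (i : ℕ) + 1) (hl : 1 ≤ b.c1) (hlet : W[b.c1 - 1]? = some (i, ε))
      (hs : b.c5.natAbs + 2 ≤ b.c4) (hsgn : 0 ≤ sgn ε * b.c5)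
      (hb' : b' = ⟨b.c1 - 1, b.c2, b.c3, b.c4, b.c5 + sgn ε, b.c6⟩)
      (hpbs : IsPBS m E W (insert b' (B.erase b))) :
      Step m E W B (insert b' (B.erase b))
  | ext1R (B : Finset PB) (b b' : PB) (hb : b ∈ B) (i : Fin m) (ε : Bool)
      (hg : b.c3 = (i : ℕ) + 1) (hlet : W[b.c2]? = some (i, ε))
      (hs : b.c5.natAbs + 2 ≤ b.c4) (hsgn : 0 ≤ sgn ε * b.c5)
      (hb' : b' = ⟨b.c1, b.c2 + 1, b.c3, b.c4, b.c5 + sgn ε, b.c6⟩)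
      (hpbs : IsPBS m E W (insert b' (B.erase b))) :
      Step m E W B (insert b' (B.erase b))
  | ext2L (B : Finset PB) (b b' : PB) (hb : b ∈ B) (i : Fin m) (ε : Bool)
      (hg : b.c3 = (i : ℕ) + 1) (hl : 1 ≤ b.c1) (hlet : W[b.c1 - 1]? = some (i, ε))
      (hs : b.c5.natAbs + 1 = b.c4) (hsgn : 0 ≤ sgn ε * b.c5)
      (hb' : b' = ⟨b.c1 - 1, b.c2, 0, 0, 0, b.c6 + 1⟩)
      (hpbs : IsPBS m E W (insert b' (B.erase b))) :
      Step m E W B (insert b' (B.erase b))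
  | ext2R (B : Finset PB) (b b' : PB) (hb : b ∈ B) (i : Fin m) (ε : Bool)
      (hg : b.c3 = (i : ℕ) + 1) (hlet : W[b.c2]? = some (i, ε))
      (hs : b.c5.natAbs + 1 = b.c4) (hsgn : 0 ≤ sgn ε * b.c5)
      (hb' : b' = ⟨b.c1, b.c2 + 1, 0, 0, 0, b.c6 + 1⟩)
      (hpbs : IsPBS m E W (insert b' (B.erase b))) :
      Step m E W B (insert b' (B.erase b))
  | ext3 (B : Finset PB) (b b' : PB) (hb : b ∈ B) (hpb1 : IsPB1 b) (i : Fin m)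
      (ε : Bool) (hl : 1 ≤ b.c1)
      (hlet1 : W[b.c1 - 1]? = some (i, ε)) (hlet2 : W[b.c2]? = some (i, !ε))
      (hb' : b' = ⟨b.c1 - 1, b.c2 + 1, 0, 0, 0, b.c6⟩)
      (hpbs : IsPBS m E W (insert b' (B.erase b))) :
      Step m E W B (insert b' (B.erase b))
  | turn (B : Finset PB) (b b' : PB) (hb : b ∈ B) (hpb1 : IsPB1 b) (i : Fin m)
      (hEi : E i ≠ {0}) (k : ℕ) (hk : k ∈ E i) (hk0 : 0 < k) (hkW : k ≤ W.length)
      (hb' : b' = ⟨b.c1, b.c2, (i : ℕ) + 1, k, 0, b.c6⟩)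
      (hpbs : IsPBS m E W (insert b' (B.erase b))) :
      Step m E W B (insert b' (B.erase b))
  | merge (B : Finset PB) (b c b' : PB) (hb : b ∈ B) (hc : c ∈ B) (hbc : b ≠ c)
      (hr : b.c2 = c.c1) (h1 : IsPB1 b ∨ IsPB1 c)
      (hb' : b' = ⟨b.c1, c.c2, b.c3 + c.c3, b.c4 + c.c4, b.c5 + c.c5, b.c6 + c.c6⟩)
      (hpbs : IsPBS m E W (insert b' ((B.erase b).erase c))) :
      Step m E W B (insert b' ((B.erase b).erase c))

section Helpers

variable {G : Type*} [Group G] {R : Set G}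

theorem ipc_zero : IsProdConj R 0 1 := ⟨Fin.elim0, Fin.elim0, fun i => i.elim0, by simp⟩

theorem ipc_one {r : G} (h : r ∈ R ∨ r⁻¹ ∈ R) : IsProdConj R 1 r :=
  ⟨fun _ => r, fun _ => 1, fun _ => h, by simp⟩

theorem ipc_mul {n k : ℕ} {g h : G} (hg : IsProdConj R n g) (hh : IsProdConj R k h) :
    IsProdConj R (n + k) (g * h) := by
  obtain ⟨r, s, hr, rfl⟩ := hg
  obtain ⟨r', s', hr', rfl⟩ := hh
  refine ⟨Fin.append r r', Fin.append s s', ?_, ?_⟩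
  · intro i
    refine Fin.addCases (fun i => ?_) (fun i => ?_) i
    · simpa using hr i
    · simpa using hr' i
  · rw [← List.prod_append, ← List.ofFn_fin_append]
    congr 2
    funext i
    refine Fin.addCases (fun i => ?_) (fun i => ?_) i <;> simp

theorem ipc_conj {n : ℕ} {g : G} (x : G) (hg : IsProdConj R n g) :
    IsProdConj R n (x * g * x⁻¹) := by
  obtain ⟨r, s, hr, rfl⟩ := hg
  refine ⟨r, fun i => x * s i, hr, ?_⟩
  rw [← MulAut.conj_apply, map_list_prod, List.map_ofFn]
  congr 2
  funext i
  simp [mul_assoc]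

theorem ipc_mem {n : ℕ} {g : G} (hg : IsProdConj R n g) :
    g ∈ Subgroup.normalClosure R := by
  obtain ⟨r, s, hr, rfl⟩ := hg
  refine Subgroup.list_prod_mem _ ?_
  intro y hy
  rw [List.mem_ofFn] at hy
  obtain ⟨i, rfl⟩ := hy
  refine (Subgroup.normalClosure_normal (s := R)).conj_mem _ ?_ _
  rcases hr i with h | h
  · exact Subgroup.subset_normalClosure h
  · exact inv_mem_iff.mp (Subgroup.subset_normalClosure h)

theorem slice_append {α : Type*} (W : List α) {p q r : ℕ} (h1 : p ≤ q) (h2 : q ≤ r)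
    (h3 : r ≤ W.length) :
    (W.take r).drop p = (W.take q).drop p ++ (W.take r).drop q := by
  have h : W.take r = W.take q ++ (W.take r).drop q := by
    conv_lhs => rw [← List.take_append_drop q (W.take r), List.take_take, min_eq_left h2]
  conv_lhs => rw [h]
  rw [List.drop_append_of_le_length]
  simp; omega

theorem slice_one {α : Type*} (W : List α) {p : ℕ} {x : α} (h : W[p]? = some x) :
    (W.take (p + 1)).drop p = [x] := by
  obtain ⟨hp, rfl⟩ := List.getElem?_eq_some_iff.mp h
  rw [List.take_add_one, h, List.drop_append_of_le_length (by simp; omega)]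
  simp

theorem evalW_append {m : ℕ} (u v : Word m) : evalW (u ++ v) = evalW u * evalW v := by
  simp [evalW, FreeGroup.mul_mk]

theorem evalW_letter {m : ℕ} (i : Fin m) (ε : Bool) :
    evalW [(i, ε)] = FreeGroup.of i ^ sgn ε := by
  cases ε
  · simp [evalW, sgn, FreeGroup.of, FreeGroup.inv_mk, FreeGroup.invRev]
  · simp [evalW, sgn, FreeGroup.of]

/-- The value in the free group of the subword `W(p..q]`. -/
def ev {m : ℕ} (W : Word m) (p q : ℕ) : FreeGroup (Fin m) := evalW ((W.take q).drop p)

theorem ev_append {m : ℕ} (W : Word m) {p q r : ℕ} (h1 : p ≤ q) (h2 : q ≤ r)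
    (h3 : r ≤ W.length) : ev W p r = ev W p q * ev W q r := by
  rw [ev, slice_append W h1 h2 h3, evalW_append]; rfl

theorem ev_one {m : ℕ} (W : Word m) {p : ℕ} {i : Fin m} {ε : Bool}
    (h : W[p]? = some (i, ε)) : ev W p (p + 1) = FreeGroup.of i ^ sgn ε := by
  rw [ev, slice_one W h, evalW_letter]

theorem ev_left {m : ℕ} (W : Word m) {p q : ℕ} {i : Fin m} {ε : Bool} (hp : 1 ≤ p)
    (h1 : p ≤ q) (h2 : q ≤ W.length)
    (h : W[p - 1]? = some (i, ε)) : ev W (p - 1) q = FreeGroup.of i ^ sgn ε * ev W p q := by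
  obtain ⟨p, rfl⟩ : ∃ t, p = t + 1 := ⟨p - 1, by omega⟩
  simp only [Nat.add_sub_cancel] at *
  rw [ev_append W (Nat.le_succ p) h1 h2, ev_one W h]

theorem ev_right {m : ℕ} (W : Word m) {p q : ℕ} {i : Fin m} {ε : Bool}
    (h1 : p ≤ q) (h : W[q]? = some (i, ε)) :
    ev W p (q + 1) = ev W p q * FreeGroup.of i ^ sgn ε := by
  obtain ⟨hq, _⟩ := List.getElem?_eq_some_iff.mp h
  rw [ev_append W h1 (Nat.le_succ q) hq, ev_one W h]

theorem rel_pow {m : ℕ} {E : Fin m → Set ℕ} {i : Fin m} {k : ℕ} {ε : Bool} {z : ℤ}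
    (hk : k ∈ E i) (hs : z.natAbs + 1 = k) (hsgn : 0 ≤ sgn ε * z) :
    IsProdConj (Rel2 m E) 1 (FreeGroup.of i ^ (z + sgn ε)) := by
  apply ipc_one
  cases ε
  · right
    refine ⟨i, k, hk, by omega, ?_⟩
    rw [← zpow_neg, ← zpow_natCast]
    congr 1
    simp only [sgn] at *
    simp at *
    omega
  · left
    refine ⟨i, k, hk, by omega, ?_⟩
    rw [← zpow_natCast]
    congr 1
    simp only [sgn] at *
    simp at *
    omega

/-- The invariant carried by a pseudobracket. -/
def Good (m : ℕ) (E : Fin m → Set ℕ) (W : Word m) (b : PB) : Prop :=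
  (IsPB1 b → IsProdConj (Rel2 m E) b.c6 (ev W b.c1 b.c2)) ∧
  (∀ j : Fin m, b.c3 = (j : ℕ) + 1 →
    IsProdConj (Rel2 m E) b.c6 (ev W b.c1 b.c2 * FreeGroup.of j ^ (-b.c5)))

theorem step_pbs {m : ℕ} {E : Fin m → Set ℕ} {W : Word m} {B B' : Finset PB}
    (h : Step m E W B B') : IsPBS m E W B' := by
  cases h <;> assumption

theorem good_insert {m : ℕ} {E : Fin m → Set ℕ} {W : Word m} {B C : Finset PB} {b' : PB}
    (h : ∀ b ∈ B, Good m E W b) (hC : C ⊆ B) (hb : Good m E W b') :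
    ∀ b ∈ insert b' C, Good m E W b := by
  intro b hb2
  rcases Finset.mem_insert.mp hb2 with rfl | h2
  · exact hb
  · exact h b (hC h2)

theorem pb2_mem {m : ℕ} {E : Fin m → Set ℕ} {W : Word m} {b : PB} {i : Fin m}
    (hv : ValidPB m E W b) (hg : b.c3 = (i : ℕ) + 1) : b.c4 ∈ E i := by
  rcases hv.2.2.2 with h | ⟨j, hj, hm, _⟩
  · have := h.1
    omega
  · have : i = j := Fin.ext (by omega)
    rwa [this]

theorem step_good {m : ℕ} {E : Fin m → Set ℕ} {W : Word m} {B B' : Finset PB}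
    (h : Step m E W B B') (hB : IsPBS m E W B) (hG : ∀ b ∈ B, Good m E W b) :
    ∀ b ∈ B', Good m E W b := by
  cases h with
  | add v hv hnot hpbs =>
    refine good_insert hG (Finset.Subset.refl _) ⟨fun _ => ?_, fun j hj => ?_⟩
    · have : ev W v v = 1 := by
        simp [ev, evalW, FreeGroup.one_eq_mk]
      simpa [this] using ipc_zero
    · simp at hj
  | ext1L b b' hb i ε hg hl hlet hs hsgn hb' hpbs =>
    subst hb'
    obtain ⟨v1, v2, -⟩ := hB.1 b hb
    refine good_insert hG (Finset.erase_subset _ _) ⟨fun h => ?_, fun j hj => ?_⟩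
    · have := h.1
      simp at this
      omega
    · obtain rfl : j = i := Fin.ext (by simp at hj; omega)
      have := ipc_conj (FreeGroup.of j ^ sgn ε) ((hG b hb).2 j hg)
      simp only
      rw [ev_left W hl v1 v2 hlet]
      convert this using 1
      group
  | ext1R b b' hb i ε hg hlet hs hsgn hb' hpbs =>
    subst hb'
    obtain ⟨v1, v2, -⟩ := hB.1 b hb
    refine good_insert hG (Finset.erase_subset _ _) ⟨fun h => ?_, fun j hj => ?_⟩
    · have := h.1
      simp at this
      omega
    · obtain rfl : j = i := Fin.ext (by simp at hj; omega)
      have := (hG b hb).2 j hg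
      simp only
      rw [ev_right W v1 hlet]
      convert this using 1
      group
  | ext2L b b' hb i ε hg hl hlet hs hsgn hb' hpbs =>
    subst hb'
    have hv := hB.1 b hb
    obtain ⟨v1, v2, -⟩ := hB.1 b hb
    refine good_insert hG (Finset.erase_subset _ _) ⟨fun h => ?_, fun j hj => ?_⟩
    · have := ipc_mul (ipc_conj (FreeGroup.of i ^ sgn ε) ((hG b hb).2 i hg))
        (rel_pow (pb2_mem hv hg) hs hsgn)
      simp only
      rw [ev_left W hl v1 v2 hlet]
      convert this using 1
      group
    · simp at hj
  | ext2R b b' hb i ε hg hlet hs hsgn hb' hpbs =>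
    subst hb'
    have hv := hB.1 b hb
    obtain ⟨v1, v2, -⟩ := hB.1 b hb
    refine good_insert hG (Finset.erase_subset _ _) ⟨fun h => ?_, fun j hj => ?_⟩
    · have := ipc_mul ((hG b hb).2 i hg) (rel_pow (pb2_mem hv hg) hs hsgn)
      simp only
      rw [ev_right W v1 hlet]
      convert this using 1
      group
    · simp at hj
  | ext3 b b' hb hpb1 i ε hl hlet1 hlet2 hb' hpbs =>
    subst hb'
    obtain ⟨v1, v2, -⟩ := hB.1 b hb
    refine good_insert hG (Finset.erase_subset _ _) ⟨fun h => ?_, fun j hj => ?_⟩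
    · have := ipc_conj (FreeGroup.of i ^ sgn ε) ((hG b hb).1 hpb1)
      simp only
      rw [ev_right W (by omega) hlet2, ev_left W hl v1 v2 hlet1]
      have e : sgn (!ε) = - sgn ε := by cases ε <;> simp [sgn]
      rw [e, zpow_neg]
      exact this
    · simp at hj
  | turn b b' hb hpb1 i hEi k hk hk0 hkW hb' hpbs =>
    subst hb'
    refine good_insert hG (Finset.erase_subset _ _) ⟨fun h => ?_, fun j hj => ?_⟩
    · have := h.1
      simp at this
    · simpa using (hG b hb).1 hpb1
  | merge b c b' hb hc hbc hr h1 hb' hpbs =>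
    subst hb'
    obtain ⟨v1, v2, -⟩ := hB.1 b hb
    obtain ⟨w1, w2, -, wt⟩ := hB.1 c hc
    have vt := (hB.1 b hb).2.2.2
    have e : ev W b.c1 c.c2 = ev W b.c1 b.c2 * ev W c.c1 c.c2 := by
      rw [ev_append W v1 (by omega) w2, hr]
    refine good_insert hG ((Finset.erase_subset _ _).trans (Finset.erase_subset _ _))
      ⟨fun h => ?_, fun j hj => ?_⟩
    · obtain ⟨h3, h4, h5⟩ := h
      simp only at h3 h4 h5 ⊢
      rw [e]
      have p1 : IsPB1 b ∧ IsPB1 c := by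
        unfold IsPB1 at *
        omega
      exact ipc_mul ((hG b hb).1 p1.1) ((hG c hc).1 p1.2)
    · simp only at hj ⊢
      rw [e]
      rcases h1 with h1 | h1
      · have := ipc_mul ((hG b hb).1 h1) ((hG c hc).2 j (by have := h1.1; omega))
        rw [h1.2.2, zero_add, mul_assoc]
        exact this
      · have := ipc_mul ((hG b hb).2 j (by have := h1.1; omega))
          (ipc_conj (FreeGroup.of j ^ b.c5) ((hG c hc).1 h1))
        rw [h1.2.2, add_zero]
        convert this using 1
        group

end Helpers

/-- Group-theoretic content of Claims (C1)–(C2) in the proof of Lemma 4.7: along any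
sequence of pseudobracket systems for `W` starting from the empty system and produced
by elementary operations, every pseudobracket `b` of type PB1 has
`W(b(1)..b(2)]` a product of `b(6)` conjugates of relators (in particular trivial in
`G_2`), and every pseudobracket of type PB2 with `b(3) = j` has
`W(b(1)..b(2)]·a_j^{-b(5)}` a product of `b(6)` conjugates of relators (in particular
`W(b(1)..b(2)] = a_j^{b(5)}` in `G_2`). -/
theorem statement10 (m : ℕ) (E : Fin m → Set ℕ)
    (hE : ∀ i, E i = {0} ∨ ∃ n : ℕ, 0 < n ∧
      (E i = {n} ∨ E i = {k | ∃ t : ℕ, 1 ≤ t ∧ k = t * n}))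
    (W : Word m) (hW : W ≠ [])
    (ℓ : ℕ) (Bs : ℕ → Finset PB) (h0 : Bs 0 = ∅)
    (hstep : ∀ i < ℓ, Step m E W (Bs i) (Bs (i + 1))) :
    ∀ i ≤ ℓ, ∀ b ∈ Bs i,
      (IsPB1 b →
        IsProdConj (Rel2 m E) b.c6 (evalW ((W.take b.c2).drop b.c1)) ∧
        evalW ((W.take b.c2).drop b.c1) ∈ Subgroup.normalClosure (Rel2 m E)) ∧
      (∀ j : Fin m, b.c3 = (j : ℕ) + 1 →
        IsProdConj (Rel2 m E) b.c6
          (evalW ((W.take b.c2).drop b.c1) * FreeGroup.of j ^ (-b.c5)) ∧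
        evalW ((W.take b.c2).drop b.c1) * (FreeGroup.of j ^ b.c5)⁻¹ ∈
          Subgroup.normalClosure (Rel2 m E)) := by
  have key : ∀ i ≤ ℓ, IsPBS m E W (Bs i) ∧ ∀ b ∈ Bs i, Good m E W b := by
    intro i
    induction i with
    | zero =>
      intro _
      rw [h0]
      simp [IsPBS]
    | succ n ih =>
      intro hn
      obtain ⟨h1, h2⟩ := ih (by omega)
      have hs := hstep n (by omega)
      exact ⟨step_pbs hs, step_good hs h1 h2⟩
  intro i hi b hb
  obtain ⟨g1, g2⟩ := (key i hi).2 b hb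
  refine ⟨fun h => ⟨g1 h, ipc_mem (g1 h)⟩, fun j hj => ⟨g2 j hj, ?_⟩⟩
  rw [← zpow_neg]
  exact ipc_mem (g2 j hj)

end Stmt10
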